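/- arXiv:1810.06182 — 2 statements merged into one kernel-verified Lean document; each statement's English description precedes it below -/
import Mathlib

section
/- Let T be a tree with vertex set {1,...,n} and nonzero real edge weights, having no vertex of degree 2. Let Δ be the squared distance matrix and L the weighted Laplacian of T, let τ be the vector with components τ_i = 2 - δ_i, let δ̂ be the vector of weighted degrees, let τ̂ be the diagonal matrix with diagonal entries 1/τ_1,...,1/τ_n, and set β = δ̂' τ̂ δ̂ and η = 2τ - L τ̂ δ̂. If β ≠ 0, then Δ is nonsingular and Δ^{-1} = -(1/4) L τ̂ L + (1/(4β)) η η'. -/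
open Finset Matrix

noncomputable section

/-- The degree of vertex `v` in the graph `T`. -/
def degr {n : ℕ} (T : SimpleGraph (Fin n)) (v : Fin n) : ℕ := (T.neighborSet v).ncard

/-- The weighted distance between `u` and `v`: the sum of the weights of the edges on
the unique `uv`-path in the tree `T` (edge `e i` goes from `(E i).1` to `(E i).2` and
has weight `w i`). -/
def wdist {n : ℕ} (T : SimpleGraph (Fin n)) (hc : T.Connected)
    (E : Fin (n-1) → Fin n × Fin n) (w : Fin (n-1) → ℝ) (u v : Fin n) : ℝ :=
  (((Nonempty.some (hc.preconnected u v)).toPath : T.Walk u v).edges.map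
    (fun s => ∑ i : Fin (n-1), if s = s((E i).1, (E i).2) then w i else 0)).sum

/-- The weighted distance matrix. -/
def distMat {n : ℕ} (T : SimpleGraph (Fin n)) (hc : T.Connected)
    (E : Fin (n-1) → Fin n × Fin n) (w : Fin (n-1) → ℝ) : Matrix (Fin n) (Fin n) ℝ :=
  Matrix.of fun u v => wdist T hc E w u v

/-- The squared distance matrix. -/
def sqDistMat {n : ℕ} (T : SimpleGraph (Fin n)) (hc : T.Connected)
    (E : Fin (n-1) → Fin n × Fin n) (w : Fin (n-1) → ℝ) : Matrix (Fin n) (Fin n) ℝ :=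
  Matrix.of fun u v => (wdist T hc E w u v) ^ 2

/-- The weighted degree of vertex `v`: the sum of the weights of the edges incident to `v`. -/
def wdeg {n : ℕ} (E : Fin (n-1) → Fin n × Fin n) (w : Fin (n-1) → ℝ) (v : Fin n) : ℝ :=
  ∑ k ∈ univ.filter (fun k => (E k).1 = v ∨ (E k).2 = v), w k

/-- The weighted Laplacian matrix: for `i ≠ j` the `(i,j)`-entry is `-1/w k` if `i` and `j`
are joined by the edge `e k` and `0` otherwise; diagonal entries make all row sums zero. -/
def lap {n : ℕ} (E : Fin (n-1) → Fin n × Fin n) (w : Fin (n-1) → ℝ) :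
    Matrix (Fin n) (Fin n) ℝ :=
  Matrix.of fun i j =>
    if i = j then ∑ k ∈ univ.filter (fun k => (E k).1 = i ∨ (E k).2 = i), (w k)⁻¹
    else -∑ k ∈ univ.filter (fun k => E k = (i, j) ∨ E k = (j, i)), (w k)⁻¹

/-- The oriented vertex-edge incidence matrix. -/
def incMat {n : ℕ} (E : Fin (n-1) → Fin n × Fin n) : Matrix (Fin n) (Fin (n-1)) ℝ :=
  Matrix.of fun v e => if (E e).1 = v then 1 else if (E e).2 = v then -1 else 0

/-- The edge orientation matrix: entry `(i,j)` is `1` if `e i` and `e j` are similarly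
oriented (`d((E i).1, (E j).1) = d((E i).2, (E j).2)` for the unweighted distance) and
`-1` otherwise. -/
def orientMat {n : ℕ} (T : SimpleGraph (Fin n)) (E : Fin (n-1) → Fin n × Fin n) :
    Matrix (Fin (n-1)) (Fin (n-1)) ℝ :=
  Matrix.of fun i j => if T.dist (E i).1 (E j).1 = T.dist (E i).2 (E j).2 then 1 else -1

/-- Edge quantity `f` seen as a function on ordered pairs of vertices. -/
def edgeFn {n : ℕ} (E : Fin (n-1) → Fin n × Fin n) (f : Fin (n-1) → ℝ) (u v : Fin n) : ℝ :=
  ∑ i : Fin (n-1), if s(u, v) = s((E i).1, (E i).2) then f i else 0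

/-- The chosen path between two vertices. -/
def thePath {n : ℕ} (T : SimpleGraph (Fin n)) (hc : T.Connected) (u v : Fin n) : T.Walk u v :=
  ((Nonempty.some (hc.preconnected u v)).toPath : T.Walk u v)

lemma thePath_isPath {n : ℕ} (T : SimpleGraph (Fin n)) (hc : T.Connected) (u v : Fin n) :
    (thePath T hc u v).IsPath := (Nonempty.some (hc.preconnected u v)).toPath.2

lemma wdist_eq {n : ℕ} (T : SimpleGraph (Fin n)) (hc : T.Connected)
    (E : Fin (n-1) → Fin n × Fin n) (w : Fin (n-1) → ℝ) (u v : Fin n) :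
    wdist T hc E w u v = ((thePath T hc u v).edges.map
    (fun s => ∑ i : Fin (n-1), if s = s((E i).1, (E i).2) then w i else 0)).sum := rfl

open Classical in
/-- The sign of the step from `k` to `j` relative to the root `i`. -/
def sgnStep {n : ℕ} (T : SimpleGraph (Fin n)) (hc : T.Connected) (i k j : Fin n) : ℝ :=
  if T.Adj k j then (if j ∈ (thePath T hc i k).support then -1 else 1) else 0

lemma edgeFn_symm {n : ℕ} (E : Fin (n-1) → Fin n × Fin n) (f : Fin (n-1) → ℝ) (u v : Fin n) :
    edgeFn E f u v = edgeFn E f v u := by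
  unfold edgeFn
  rw [Sym2.eq_swap]

lemma edgeFn_adj {n : ℕ} (T : SimpleGraph (Fin n)) (E : Fin (n-1) → Fin n × Fin n)
    (hinj : Function.Injective fun i => (s((E i).1, (E i).2) : Sym2 (Fin n)))
    (hsurj : ∀ e ∈ T.edgeSet, ∃ i, e = s((E i).1, (E i).2)) {u v : Fin n} (h : T.Adj u v) :
    ∃ k, ∀ f : Fin (n-1) → ℝ, edgeFn E f u v = f k := by
  obtain ⟨k, hk⟩ := hsurj s(u, v) h
  refine ⟨k, fun f => ?_⟩
  unfold edgeFn
  rw [Finset.sum_eq_single k]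
  · simp [hk]
  · intro b _ hb
    rw [if_neg]
    intro hh
    exact hb (hinj (hh.symm.trans hk))
  · simp

lemma edgeFn_not_adj {n : ℕ} (T : SimpleGraph (Fin n)) (E : Fin (n-1) → Fin n × Fin n)
    (hE : ∀ i, T.Adj (E i).1 (E i).2) {u v : Fin n} (h : ¬ T.Adj u v) (f : Fin (n-1) → ℝ) :
    edgeFn E f u v = 0 := by
  unfold edgeFn
  refine Finset.sum_eq_zero fun k _ => ?_
  rw [if_neg]
  intro hh
  apply h
  rw [← SimpleGraph.mem_edgeSet, hh]
  exact hE k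

lemma edgeFn_sum {n : ℕ} (T : SimpleGraph (Fin n)) (E : Fin (n-1) → Fin n × Fin n)
    (hE : ∀ i, T.Adj (E i).1 (E i).2) (f : Fin (n-1) → ℝ) (v : Fin n) :
    ∑ j, edgeFn E f v j = ∑ k ∈ univ.filter (fun k => (E k).1 = v ∨ (E k).2 = v), f k := by
  unfold edgeFn
  rw [Finset.sum_comm, Finset.sum_filter]
  refine Finset.sum_congr rfl fun k _ => ?_
  have hne := (hE k).ne
  by_cases h1 : (E k).1 = v
  · rw [if_pos (Or.inl h1), Finset.sum_eq_single (E k).2]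
    · simp [h1]
    · intro b _ hb
      rw [if_neg]
      intro hh
      rw [Sym2.eq_iff] at hh
      grind
    · simp
  · by_cases h2 : (E k).2 = v
    · rw [if_pos (Or.inr h2), Finset.sum_eq_single (E k).1]
      · rw [if_pos]
        rw [Sym2.eq_iff]
        grind
      · intro b _ hb
        rw [if_neg]
        intro hh
        rw [Sym2.eq_iff] at hh
        grind
      · simp
    · rw [if_neg (by tauto)]
      refine Finset.sum_eq_zero fun b _ => ?_
      rw [if_neg]
      intro hh
      rw [Sym2.eq_iff] at hh
      grind

lemma lap_apply {n : ℕ} (T : SimpleGraph (Fin n)) (E : Fin (n-1) → Fin n × Fin n)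
    (hE : ∀ i, T.Adj (E i).1 (E i).2) (w : Fin (n-1) → ℝ) (i j : Fin n) :
    lap E w i j = (if i = j then ∑ l, edgeFn E (fun k => (w k)⁻¹) j l else 0)
      - edgeFn E (fun k => (w k)⁻¹) j i := by
  unfold lap
  simp only [Matrix.of_apply]
  split_ifs with h
  · subst h
    rw [edgeFn_not_adj T E hE (T.loopless.irrefl i), edgeFn_sum T E hE, sub_zero]
  · unfold edgeFn
    rw [zero_sub, Finset.sum_filter]
    congr 1
    refine Finset.sum_congr rfl fun k _ => ?_
    congr 1
    rw [Sym2.eq_iff, Prod.ext_iff, Prod.ext_iff]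
    apply propext
    grind

lemma mul_lap {n : ℕ} (T : SimpleGraph (Fin n)) (E : Fin (n-1) → Fin n × Fin n)
    (hE : ∀ i, T.Adj (E i).1 (E i).2) (w : Fin (n-1) → ℝ) (M : Matrix (Fin n) (Fin n) ℝ)
    (i k : Fin n) :
    (M * lap E w) i k = ∑ j, edgeFn E (fun k => (w k)⁻¹) k j * (M i k - M i j) := by
  rw [Matrix.mul_apply]
  simp only [lap_apply T E hE, mul_sub, mul_ite, mul_zero, Finset.sum_sub_distrib,
    Finset.sum_ite_eq', Finset.mem_univ, if_true, Finset.mul_sum]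
  congr 1 <;> exact Finset.sum_congr rfl fun j _ => mul_comm _ _

lemma wdist_self {n : ℕ} (T : SimpleGraph (Fin n)) (hc : T.Connected)
    (E : Fin (n-1) → Fin n × Fin n) (w : Fin (n-1) → ℝ) (i : Fin n) :
    wdist T hc E w i i = 0 := by
  rw [wdist_eq, SimpleGraph.Walk.isPath_iff_eq_nil.1 (thePath_isPath T hc i i)]
  simp

lemma sgnStep_symm {n : ℕ} (T : SimpleGraph (Fin n)) (hT : T.IsTree) (i k j : Fin n) :
    sgnStep T hT.isConnected i j k = - sgnStep T hT.isConnected i k j := by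
  unfold sgnStep
  by_cases h : T.Adj k j
  · rw [if_pos h, if_pos h.symm]
    by_cases hj : j ∈ (thePath T hT.isConnected i k).support
    · have := hT.isAcyclic.ne_mem_support_of_support_of_adj_of_isPath
        (thePath_isPath T hT.isConnected i k) (thePath_isPath T hT.isConnected i j) h hj
      simp [hj, this]
    · have := hT.isAcyclic.mem_support_of_ne_mem_support_of_adj_of_isPath
        (thePath_isPath T hT.isConnected i j) (thePath_isPath T hT.isConnected i k) h.symm hj
      simp [hj, this]
  · rw [if_neg h, if_neg (fun hh => h hh.symm), neg_zero]

lemma wdist_concat {n : ℕ} (T : SimpleGraph (Fin n)) (hT : T.IsTree)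
    (E : Fin (n-1) → Fin n × Fin n) (w : Fin (n-1) → ℝ) (i k j : Fin n) (h : T.Adj k j)
    (hk : k ∈ (thePath T hT.isConnected i j).support) :
    wdist T hT.isConnected E w i j = wdist T hT.isConnected E w i k + edgeFn E w k j := by
  rw [wdist_eq, wdist_eq, hT.isAcyclic.path_concat (thePath_isPath T hT.isConnected i k)
    (thePath_isPath T hT.isConnected i j) h hk, SimpleGraph.Walk.edges_concat]
  simp [edgeFn]

lemma wdist_step {n : ℕ} (T : SimpleGraph (Fin n)) (hT : T.IsTree)
    (E : Fin (n-1) → Fin n × Fin n) (w : Fin (n-1) → ℝ) (i k j : Fin n) (h : T.Adj k j) :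
    wdist T hT.isConnected E w i j = wdist T hT.isConnected E w i k
      + sgnStep T hT.isConnected i k j * edgeFn E w k j := by
  unfold sgnStep
  rw [if_pos h]
  by_cases hj : j ∈ (thePath T hT.isConnected i k).support
  · have := wdist_concat T hT E w i j k h.symm hj
    rw [if_pos hj, this, edgeFn_symm E w k j]
    ring
  · have := hT.isAcyclic.mem_support_of_ne_mem_support_of_adj_of_isPath
        (thePath_isPath T hT.isConnected i j) (thePath_isPath T hT.isConnected i k) h.symm hj
    rw [if_neg hj, wdist_concat T hT E w i k j h this, one_mul]

lemma sgnStep_sq {n : ℕ} (T : SimpleGraph (Fin n)) (hc : T.Connected) (i k j : Fin n)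
    (h : T.Adj k j) : sgnStep T hc i k j * sgnStep T hc i k j = 1 := by
  unfold sgnStep
  rw [if_pos h]
  split_ifs <;> norm_num

lemma degr_eq {n : ℕ} (T : SimpleGraph (Fin n)) (v : Fin n) [DecidableRel T.Adj] :
    (degr T v : ℝ) = ∑ j, if T.Adj v j then (1 : ℝ) else 0 := by
  unfold degr
  rw [Set.ncard_eq_toFinset_card']
  rw [Finset.sum_boole]
  congr 2
  ext j
  simp

lemma sgnStep_sum {n : ℕ} (T : SimpleGraph (Fin n)) (hT : T.IsTree) (i k : Fin n) :
    ∑ j, sgnStep T hT.isConnected i k j = (degr T k : ℝ) - 2 + if i = k then 2 else 0 := by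
  classical
  rw [degr_eq]
  have key : ∀ j, sgnStep T hT.isConnected i k j = (if T.Adj k j then (1 : ℝ) else 0)
      - 2 * (if T.Adj k j ∧ j ∈ (thePath T hT.isConnected i k).support then 1 else 0) := by
    intro j
    unfold sgnStep
    by_cases h : T.Adj k j <;>
      by_cases h2 : j ∈ (thePath T hT.isConnected i k).support <;> simp [h, h2]
    norm_num
  simp only [key, Finset.sum_sub_distrib, ← Finset.mul_sum]
  by_cases hik : i = k
  · subst hik
    rw [if_pos rfl, Finset.sum_eq_zero (f := fun j => if T.Adj i j ∧
      j ∈ (thePath T hT.isConnected i i).support then (1 : ℝ) else 0)]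
    · ring
    · intro j _
      rw [if_neg]
      rintro ⟨h1, h2⟩
      rw [SimpleGraph.Walk.isPath_iff_eq_nil.1 (thePath_isPath T hT.isConnected i i)] at h2
      simp at h2
      exact h1.ne h2.symm
  · rw [if_neg hik, Finset.sum_eq_single (f := fun j => if T.Adj k j ∧
      j ∈ (thePath T hT.isConnected i k).support then (1 : ℝ) else 0)
      (thePath T hT.isConnected i k).penultimate]
    · rw [if_pos]
      · ring
      · exact ⟨((thePath T hT.isConnected i k).adj_penultimate
          (SimpleGraph.Walk.not_nil_of_ne hik)).symm,
          SimpleGraph.Walk.getVert_mem_support _ _⟩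
    · intro b _ hb
      rw [if_neg]
      rintro ⟨h1, h2⟩
      exact hb (hT.isAcyclic.eq_penultimate_of_adj_end
        (thePath_isPath T hT.isConnected i k) h1 h2)
    · simp

lemma dist_mul_lap {n : ℕ} (T : SimpleGraph (Fin n)) (hT : T.IsTree)
    (E : Fin (n - 1) → Fin n × Fin n) (w : Fin (n - 1) → ℝ)
    (hw : ∀ i, w i ≠ 0)
    (hE : ∀ i, T.Adj (E i).1 (E i).2)
    (hinj : Function.Injective fun i => (s((E i).1, (E i).2) : Sym2 (Fin n)))
    (hsurj : ∀ e ∈ T.edgeSet, ∃ i, e = s((E i).1, (E i).2))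
    (i k : Fin n) :
    (distMat T hT.isConnected E w * lap E w) i k
      = (2 - (degr T k : ℝ)) - if i = k then 2 else 0 := by
  rw [mul_lap T E hE]
  have : ∀ j, edgeFn E (fun k => (w k)⁻¹) k j * (distMat T hT.isConnected E w i k
      - distMat T hT.isConnected E w i j) = - sgnStep T hT.isConnected i k j := by
    intro j
    by_cases h : T.Adj k j
    · obtain ⟨e, he⟩ := edgeFn_adj T E hinj hsurj h
      simp only [distMat, Matrix.of_apply]
      rw [wdist_step T hT E w i k j h, he, he]
      have := hw e
      field_simp
      ring
    · rw [edgeFn_not_adj T E hE h]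
      simp [sgnStep, h]
  simp only [this, Finset.sum_neg_distrib, sgnStep_sum T hT]
  ring

lemma sqDist_mul_lap {n : ℕ} (T : SimpleGraph (Fin n)) (hT : T.IsTree)
    (E : Fin (n - 1) → Fin n × Fin n) (w : Fin (n - 1) → ℝ)
    (hw : ∀ i, w i ≠ 0)
    (hE : ∀ i, T.Adj (E i).1 (E i).2)
    (hinj : Function.Injective fun i => (s((E i).1, (E i).2) : Sym2 (Fin n)))
    (hsurj : ∀ e ∈ T.edgeSet, ∃ i, e = s((E i).1, (E i).2))
    (i k : Fin n) :
    (sqDistMat T hT.isConnected E w * lap E w) i k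
      = 2 * wdist T hT.isConnected E w i k * (2 - (degr T k : ℝ)) - wdeg E w k := by
  rw [mul_lap T E hE]
  have : ∀ j, edgeFn E (fun k => (w k)⁻¹) k j * (sqDistMat T hT.isConnected E w i k
      - sqDistMat T hT.isConnected E w i j) = - (2 * wdist T hT.isConnected E w i k) *
        sgnStep T hT.isConnected i k j - edgeFn E w k j := by
    intro j
    by_cases h : T.Adj k j
    · obtain ⟨e, he⟩ := edgeFn_adj T E hinj hsurj h
      simp only [sqDistMat, Matrix.of_apply]
      have hs := sgnStep_sq T hT.isConnected i k j h
      rw [wdist_step T hT E w i k j h, he, he]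
      have := hw e
      field_simp
      linear_combination (- w e ^ 2) * hs
    · rw [edgeFn_not_adj T E hE h, edgeFn_not_adj T E hE h]
      simp [sgnStep, h]
  simp only [this, Finset.sum_sub_distrib, ← Finset.mul_sum, sgnStep_sum T hT, edgeFn_sum T E hE, wdeg]
  by_cases hik : i = k
  · subst hik
    simp [wdist_self]
  · rw [if_neg hik]
    ring

lemma sqDist_tau {n : ℕ} (T : SimpleGraph (Fin n)) (hT : T.IsTree)
    (E : Fin (n - 1) → Fin n × Fin n) (w : Fin (n - 1) → ℝ)
    (hE : ∀ i, T.Adj (E i).1 (E i).2)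
    (hinj : Function.Injective fun i => (s((E i).1, (E i).2) : Sym2 (Fin n)))
    (hsurj : ∀ e ∈ T.edgeSet, ∃ i, e = s((E i).1, (E i).2))
    (i : Fin n) :
    ∑ k, wdist T hT.isConnected E w i k ^ 2 * (2 - (degr T k : ℝ))
      = ∑ k, wdist T hT.isConnected E w i k * wdeg E w k := by
  set d := fun k => wdist T hT.isConnected E w i k with hd
  set S := sgnStep T hT.isConnected i with hS
  have h1 : ∀ k, wdist T hT.isConnected E w i k ^ 2 * (2 - (degr T k : ℝ))
      = - ∑ j, d k ^ 2 * S k j := by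
    intro k
    rw [← Finset.mul_sum, hS, sgnStep_sum T hT]
    by_cases hik : i = k
    · subst hik
      simp [hd, wdist_self]
    · rw [if_neg hik]
      simp only [hd]
      ring
  have h2 : ∀ k, wdist T hT.isConnected E w i k * wdeg E w k = ∑ j, d k * edgeFn E w k j := by
    intro k
    rw [← Finset.mul_sum, edgeFn_sum T E hE, wdeg]
  simp only [h1, h2, Finset.sum_neg_distrib]
  have h3 : ∑ k, ∑ j, d k ^ 2 * S k j = - ∑ k, ∑ j, d j ^ 2 * S k j := by
    rw [Finset.sum_comm]
    simp only [← Finset.sum_neg_distrib]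
    refine Finset.sum_congr rfl fun k _ => Finset.sum_congr rfl fun j _ => ?_
    rw [hS, sgnStep_symm T hT i k j]
    ring
  have h4 : ∑ k, ∑ j, d k * edgeFn E w k j = ∑ k, ∑ j, d j * edgeFn E w k j := by
    rw [Finset.sum_comm]
    refine Finset.sum_congr rfl fun k _ => Finset.sum_congr rfl fun j _ => ?_
    rw [edgeFn_symm]
  have h5 : ∑ k, ∑ j, d j ^ 2 * S k j - ∑ k, ∑ j, d k ^ 2 * S k j
      = ∑ k, ∑ j, d k * edgeFn E w k j + ∑ k, ∑ j, d j * edgeFn E w k j := by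
    simp only [← Finset.sum_sub_distrib, ← Finset.sum_add_distrib]
    refine Finset.sum_congr rfl fun k _ => Finset.sum_congr rfl fun j _ => ?_
    by_cases h : T.Adj k j
    · have hs := sgnStep_sq T hT.isConnected i k j h
      have hd2 : d j = d k + S k j * edgeFn E w k j := wdist_step T hT E w i k j h
      rw [hd2]
      change S k j * S k j = 1 at hs
      linear_combination (2 * d k * edgeFn E w k j + S k j * edgeFn E w k j ^ 2) * hs
    · rw [edgeFn_not_adj T E hE h]
      simp [hS, sgnStep, h]
  linarith


theorem stmt17 {n : ℕ} (T : SimpleGraph (Fin n)) (hT : T.IsTree)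
    (E : Fin (n - 1) → Fin n × Fin n) (w : Fin (n - 1) → ℝ)
    (hw : ∀ i, w i ≠ 0)
    (hE : ∀ i, T.Adj (E i).1 (E i).2)
    (hinj : Function.Injective fun i => (s((E i).1, (E i).2) : Sym2 (Fin n)))
    (hsurj : ∀ e ∈ T.edgeSet, ∃ i, e = s((E i).1, (E i).2))
    (hdeg : ∀ v, degr T v ≠ 2)
    (β : ℝ) (hβdef : β = wdeg E w ⬝ᵥ (Matrix.diagonal (fun v => (2 - (degr T v : ℝ))⁻¹) *ᵥ wdeg E w))
    (η : Fin n → ℝ)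
    (hηdef : η = (2 : ℝ) • (fun v => 2 - (degr T v : ℝ))
      - lap E w *ᵥ (Matrix.diagonal (fun v => (2 - (degr T v : ℝ))⁻¹) *ᵥ wdeg E w))
    (hβ : β ≠ 0) :
    (sqDistMat T hT.isConnected E w).det ≠ 0 ∧
      (sqDistMat T hT.isConnected E w)⁻¹
        = (-(1 / 4) : ℝ) • (lap E w * Matrix.diagonal (fun v => (2 - (degr T v : ℝ))⁻¹) * lap E w)
          + (1 / (4 * β)) • Matrix.vecMulVec η η := by
  set τi : Fin n → ℝ := fun v => (2 - (degr T v : ℝ))⁻¹ with hτi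
  have hτ : ∀ v, (2 - (degr T v : ℝ)) ≠ 0 := by
    intro v h
    apply hdeg v
    have : (degr T v : ℝ) = 2 := by linarith
    exact_mod_cast this
  set D := distMat T hT.isConnected E w with hD
  set Δ := sqDistMat T hT.isConnected E w with hΔ
  set L := lap E w with hL
  set u := Matrix.diagonal τi *ᵥ wdeg E w with hu
  have hLsymm : Lᵀ = L := by
    ext a b
    rw [Matrix.transpose_apply, hL, lap_apply T E hE, lap_apply T E hE, edgeFn_symm]
    by_cases h : a = b
    · subst h; rfl
    · rw [if_neg h, if_neg (Ne.symm h)]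
  have hDL : D * L = vecMulVec (fun _ => 1) (fun v => 2 - (degr T v : ℝ))
      - (2 : ℝ) • (1 : Matrix (Fin n) (Fin n) ℝ) := by
    ext a b
    rw [hD, hL, dist_mul_lap T hT E w hw hE hinj hsurj]
    simp [vecMulVec_apply, Matrix.one_apply]
  have hΔL : Δ * L * Matrix.diagonal τi = (2 : ℝ) • D - vecMulVec (fun _ => 1) u := by
    ext a b
    rw [Matrix.mul_diagonal, hΔ, hL, sqDist_mul_lap T hT E w hw hE hinj hsurj]
    have := hτ b
    simp [vecMulVec_apply, hu, Matrix.mulVec_diagonal, hD, distMat, hτi]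
    field_simp
  have hΔLL : Δ * (L * Matrix.diagonal τi * L) = vecMulVec (fun _ => 1) η
      - (4 : ℝ) • (1 : Matrix (Fin n) (Fin n) ℝ) := by
    rw [← Matrix.mul_assoc, ← Matrix.mul_assoc, hΔL, Matrix.sub_mul, Matrix.smul_mul, hDL,
      Matrix.vecMulVec_mul, ← Matrix.mulVec_transpose, hLsymm, hηdef]
    ext a b
    simp [vecMulVec_apply, Matrix.one_apply]
    split_ifs <;> ring
  have hΔη : Δ *ᵥ η = fun _ => β := by
    have h1 : Δ *ᵥ (L *ᵥ u) = (2 : ℝ) • (D *ᵥ wdeg E w) - fun _ => β := by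
      rw [hu, Matrix.mulVec_mulVec, Matrix.mulVec_mulVec, hΔL, Matrix.sub_mulVec,
        Matrix.smul_mulVec, hβdef]
      congr 1
      ext a
      simp [Matrix.mulVec, dotProduct, vecMulVec_apply, mul_comm]
    have h2 : Δ *ᵥ (fun v => 2 - (degr T v : ℝ)) = D *ᵥ wdeg E w := by
      ext a
      exact sqDist_tau T hT E w hE hinj hsurj a
    rw [hηdef, Matrix.mulVec_sub, Matrix.mulVec_smul, h1, h2]
    ext a
    simp
  have hmul : Δ * ((-(1 / 4) : ℝ) • (L * Matrix.diagonal τi * L)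
          + (1 / (4 * β)) • Matrix.vecMulVec η η) = 1 := by
    rw [Matrix.mul_add, Matrix.mul_smul, Matrix.mul_smul, hΔLL, Matrix.mul_vecMulVec, hΔη]
    ext a b
    simp [vecMulVec_apply, Matrix.one_apply]
    field_simp
    split_ifs <;> ring
  refine ⟨?_, Matrix.inv_eq_right_inv hmul⟩
  intro h0
  have := congrArg Matrix.det hmul
  rw [Matrix.det_mul, h0, zero_mul, Matrix.det_one] at this
  exact zero_ne_one this


end
end

section
/- Let T be a tree with vertex set {1,...,n} whose edges are assigned nonzero real weights, and let d denote the weighted distance. If e_p = {i,j} and e_q = {k,ℓ} are edges of T, then d(i,k) + d(j,ℓ) - d(i,ℓ) - d(j,k) equals 0 if e_p and e_q are distinct edges, and equals -2 w_p if e_p = e_q (i.e., {i,j} = {k,ℓ} with i = k and j = ℓ). -/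
open Finset Matrix

noncomputable section

lemma wdist_eq_path {n : ℕ} (T : SimpleGraph (Fin n)) (hT : T.IsTree)
    (E : Fin (n - 1) → Fin n × Fin n) (w : Fin (n - 1) → ℝ) {u v : Fin n}
    (P : T.Walk u v) (hP : P.IsPath) :
    wdist T hT.isConnected E w u v = (P.edges.map
      (fun s => ∑ i : Fin (n-1), if s = s((E i).1, (E i).2) then w i else 0)).sum := by
  unfold wdist
  rw [hT.isAcyclic.path_unique (Nonempty.some (hT.isConnected.preconnected u v)).toPath ⟨P, hP⟩]

lemma wdist_step_s18 {n : ℕ} (T : SimpleGraph (Fin n)) (hT : T.IsTree)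
    (E : Fin (n - 1) → Fin n × Fin n) (w : Fin (n - 1) → ℝ) {u a b : Fin n}
    (hab : T.Adj a b) (W : T.Walk u a) (hW : s(a, b) ∉ W.edges) :
    wdist T hT.isConnected E w u b = wdist T hT.isConnected E w u a
      + ∑ i : Fin (n-1), if s(a, b) = s((E i).1, (E i).2) then w i else 0 := by
  have h1 : s(a, b) ∉ (W.toPath : T.Walk u a).edges :=
    fun h => hW (W.edges_toPath_subset h)
  have h2 : ((W.toPath : T.Walk u a).concat hab).IsPath := by
    rw [hT.isAcyclic.isPath_iff_isTrail]
    rw [SimpleGraph.Walk.isTrail_def, SimpleGraph.Walk.edges_concat, List.concat_eq_append]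
    have h3 := W.toPath.2.isTrail.edges_nodup
    rw [List.nodup_append]
    refine ⟨h3, by simp, ?_⟩
    intro x hx y hy hxy
    simp only [List.mem_singleton] at hy
    subst hxy
    subst hy
    exact h1 hx
  rw [wdist_eq_path T hT E w _ h2, wdist_eq_path T hT E w _ W.toPath.2]
  simp [SimpleGraph.Walk.edges_concat, List.concat_eq_append]

lemma exists_avoiding {n : ℕ} (T : SimpleGraph (Fin n)) {u c : Fin n} (a b : Fin n)
    (W : T.Walk u c) (hc : c = a) :
    (∃ P : T.Walk u a, s(a, b) ∉ P.edges) ∨ (∃ P : T.Walk u b, s(a, b) ∉ P.edges) := by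
  induction W with
  | nil => subst hc; exact Or.inl ⟨SimpleGraph.Walk.nil, by simp⟩
  | @cons u x _ h W ih =>
    by_cases hux : s(a, b) = s(u, x)
    · rcases Sym2.eq_iff.mp hux with ⟨h1, h2⟩ | ⟨h1, h2⟩
      · subst h1; exact Or.inl ⟨SimpleGraph.Walk.nil, by simp⟩
      · subst h2; exact Or.inr ⟨SimpleGraph.Walk.nil, by simp⟩
    · rcases ih hc with ⟨P, hP⟩ | ⟨P, hP⟩
      · exact Or.inl ⟨P.cons h, by simp only [SimpleGraph.Walk.edges_cons, List.mem_cons]; tauto⟩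
      · exact Or.inr ⟨P.cons h, by simp only [SimpleGraph.Walk.edges_cons, List.mem_cons]; tauto⟩

theorem stmt18 {n : ℕ} (T : SimpleGraph (Fin n)) (hT : T.IsTree)
    (E : Fin (n - 1) → Fin n × Fin n) (w : Fin (n - 1) → ℝ)
    (hw : ∀ i, w i ≠ 0)
    (hE : ∀ i, T.Adj (E i).1 (E i).2)
    (hinj : Function.Injective fun i => (s((E i).1, (E i).2) : Sym2 (Fin n)))
    (hsurj : ∀ e ∈ T.edgeSet, ∃ i, e = s((E i).1, (E i).2))
    (p q : Fin (n - 1)) :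
    wdist T hT.isConnected E w (E p).1 (E q).1 + wdist T hT.isConnected E w (E p).2 (E q).2
      - wdist T hT.isConnected E w (E p).1 (E q).2
      - wdist T hT.isConnected E w (E p).2 (E q).1
      = if p = q then -2 * w p else 0 := by
  have hq := hE q
  have hp := hE p
  have key : ∀ P : Fin n, (∑ i : Fin (n-1), if s((E q).1, (E q).2) = s((E i).1, (E i).2)
      then w i else 0) = w q := by
    intro _
    rw [Finset.sum_eq_single q]
    · simp
    · intro i _ hi
      rw [if_neg]
      intro h
      exact hi (hinj h.symm)
    · simp
  have k1 := key (E q).1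
  have A : ∀ u, ∀ W : T.Walk u (E q).1, s((E q).1, (E q).2) ∉ W.edges →
      wdist T hT.isConnected E w u (E q).2 = wdist T hT.isConnected E w u (E q).1 + w q := by
    intro u W hW
    rw [wdist_step_s18 T hT E w hq W hW, k1]
  have B : ∀ u, ∀ W : T.Walk u (E q).2, s((E q).1, (E q).2) ∉ W.edges →
      wdist T hT.isConnected E w u (E q).1 = wdist T hT.isConnected E w u (E q).2 + w q := by
    intro u W hW
    rw [wdist_step_s18 T hT E w hq.symm W (by rwa [Sym2.eq_swap]), Sym2.eq_swap, k1]
  split_ifs with hpq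
  · subst hpq
    have h1 := A (E p).1 SimpleGraph.Walk.nil (by simp)
    have h2 := B (E p).2 SimpleGraph.Walk.nil (by simp)
    linarith
  · have hne : s((E q).1, (E q).2) ≠ s((E p).2, (E p).1) := by
      rw [Sym2.eq_swap (a := (E p).2)]
      intro h
      exact hpq (hinj h.symm)
    rcases exists_avoiding T (E q).1 (E q).2
      (Nonempty.some (hT.isConnected.preconnected (E p).1 (E q).1)) rfl with ⟨P, hP⟩ | ⟨P, hP⟩
    · have h1 := A _ P hP
      have h2 := A _ (P.cons hp.symm)
        (by simp only [SimpleGraph.Walk.edges_cons, List.mem_cons]; tauto)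
      linarith
    · have h1 := B _ P hP
      have h2 := B _ (P.cons hp.symm)
        (by simp only [SimpleGraph.Walk.edges_cons, List.mem_cons]; tauto)
      linarith

end
end
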